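/- Let n, t, q, z₂, s be natural numbers with s ≤ q, q + z₂ ≤ 2t and n ≥ 2t, and set N := n − 2t + q + z₂. Then for every integer j: C(N, j+s) · C(N, j) · C(q+z₂, s+z₂) · C(N+q+z₂, q+z₂) = C(N+q+z₂, j+q) · Σ_{u=0}^{z₂} Σ_{v=0}^{q−s} Σ_{w=0}^{z₂−u} C(z₂, u) · C(N, u+s) · C(N−u+v, v) · C(q, s+v) · C(z₂−u, w) · C(n−2t, j−v−w). -/

import Mathlib

/-- Binomial coefficient for integer arguments, with the convention
`ibinom x k = 0` whenever `k < 0` or `k > x`. -/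
def ibinom (x k : ℤ) : ℤ :=
  if 0 ≤ k ∧ k ≤ x then Nat.choose x.toNat k.toNat else 0

theorem ibinom_natCast (m k : ℕ) : ibinom m k = m.choose k := by
  by_cases h : k ≤ m
  · simp [ibinom, h]
  · simp [ibinom, h, Nat.choose_eq_zero_of_lt (not_le.mp h)]

theorem ibinom_of_neg (x : ℤ) {k : ℤ} (hk : k < 0) : ibinom x k = 0 :=
  if_neg fun h => by omega

theorem ibinom_of_lt {x k : ℤ} (hk : x < k) : ibinom x k = 0 :=
  if_neg fun h => by omega

theorem ibinom_succ {x : ℤ} (hx : 0 ≤ x) (k : ℤ) :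
    ibinom (x + 1) k = ibinom x k + ibinom x (k - 1) := by
  lift x to ℕ using hx
  rcases lt_trichotomy k 0 with hk | rfl | hk
  · rw [ibinom_of_neg _ hk, ibinom_of_neg _ hk, ibinom_of_neg _ (by omega), add_zero]
  · rw [ibinom_of_neg _ (show (0 : ℤ) - 1 < 0 by omega)]
    simp [ibinom]
    omega
  · obtain ⟨m, rfl⟩ : ∃ m : ℕ, k = m + 1 := ⟨(k - 1).toNat, by omega⟩
    rw [add_sub_cancel_right]
    have h₁ := ibinom_natCast (x + 1) (m + 1)
    have h₂ := ibinom_natCast x (m + 1)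
    push_cast at h₁ h₂
    rw [h₁, h₂, ibinom_natCast, Nat.choose_succ_succ]
    push_cast
    ring

theorem ibinom_symm (x k : ℤ) : ibinom x (x - k) = ibinom x k := by
  by_cases h : 0 ≤ k ∧ k ≤ x
  · obtain ⟨h0, hx⟩ := h
    lift k to ℕ using h0
    lift x to ℕ using by omega
    have hk : k ≤ x := by omega
    rw [← Nat.cast_sub hk, ibinom_natCast, ibinom_natCast, Nat.choose_symm hk]
  · rw [ibinom, ibinom, if_neg h, if_neg (by omega)]

theorem ibinom_mul (x k i : ℤ) :
    ibinom x k * ibinom k i = ibinom x i * ibinom (x - i) (k - i) := by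
  by_cases h : 0 ≤ i ∧ i ≤ k ∧ k ≤ x
  · obtain ⟨h0, hk, hx⟩ := h
    lift i to ℕ using h0
    lift k to ℕ using by omega
    lift x to ℕ using by omega
    have hk' : i ≤ k := by omega
    have hx' : k ≤ x := by omega
    rw [← Nat.cast_sub hk', ← Nat.cast_sub (hk'.trans hx')]
    simp only [ibinom_natCast]
    exact_mod_cast Nat.choose_mul hk'
  · unfold ibinom
    split_ifs <;> omega

/-- Vandermonde's convolution, with any summation range that contains the support. -/
theorem sum_range_ibinom_mul_ibinom {m T : ℕ} (hT : m < T) {y : ℤ} (hy : 0 ≤ y) (k : ℤ) :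
    ∑ i ∈ Finset.range T, ibinom m i * ibinom y (k - i) = ibinom (m + y) k := by
  induction m generalizing T k with
  | zero =>
    rw [Finset.sum_eq_single_of_mem 0 (Finset.mem_range.mpr hT)]
    · simp [ibinom]
    · intro i _ hi
      rw [ibinom_of_lt (by omega), zero_mul]
  | succ m ih =>
    obtain ⟨T, rfl⟩ : ∃ T', T = T' + 1 := ⟨T - 1, by omega⟩
    have hm : (0 : ℤ) ≤ m := by omega
    push_cast
    simp only [ibinom_succ hm, add_mul, Finset.sum_add_distrib]
    rw [ih (by omega), Finset.sum_range_succ', ibinom_of_neg m (by simp), zero_mul, add_zero,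
      add_right_comm, ibinom_succ (by omega), ← ih (T := T) (by omega) (k - 1)]
    congr 1
    refine Finset.sum_congr rfl fun i _ => ?_
    push_cast
    rw [add_sub_cancel_right, sub_sub, add_comm (1 : ℤ)]

theorem sum_range_shift {s q : ℕ} (hs : s ≤ q) {f : ℕ → ℤ} (hf : ∀ k < s, f k = 0) :
    ∑ k ∈ Finset.range (q + 1), f k = ∑ v ∈ Finset.range (q - s + 1), f (s + v) := by
  rw [show q + 1 = s + (q - s + 1) by omega, Finset.sum_range_add,
    Finset.sum_eq_zero fun k hk => hf k (Finset.mem_range.mp hk), zero_add]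

/-- A form of the Pfaff–Saalschütz identity. -/
theorem sum_range_ibinom_saalschutz {q s : ℕ} (hs : s ≤ q) {M j : ℤ} (hM : q ≤ M) (hj : 0 ≤ j) :
    ∑ k ∈ Finset.range (q + 1),
        ibinom (M - s + k) M * ibinom q k * ibinom (M - q) (j + s - k) =
      ibinom (M - s) j * ibinom (q + j) (j + s) := by
  calc
    _ = ∑ k ∈ Finset.range (q + 1), ∑ i ∈ Finset.range (q + 1),
          ibinom (M - s) (M - i) * (ibinom q i *
            (ibinom (q - i) (k - i) * ibinom (M - q) (j + s - k))) := by
      refine Finset.sum_congr rfl fun k hk => ?_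
      rw [add_comm (M - s : ℤ), ← sum_range_ibinom_mul_ibinom (Finset.mem_range.mp hk) (by omega),
        Finset.sum_mul, Finset.sum_mul]
      refine Finset.sum_congr rfl fun i _ => ?_
      linear_combination ibinom (M - s) (M - i) * ibinom (M - q) (j + s - k) * ibinom_mul q k i
    _ = ∑ i ∈ Finset.range (q + 1), ibinom (M - s) j * (ibinom q i * ibinom j (j + s - i)) := by
      rw [Finset.sum_comm]
      refine Finset.sum_congr rfl fun i hi => ?_
      have hi' : i ≤ q := Nat.lt_succ_iff.mp (Finset.mem_range.mp hi)
      rw [← Finset.mul_sum, ← Finset.mul_sum, sum_range_shift hi' fun k hk => by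
        rw [ibinom_of_neg _ (by omega), zero_mul]]
      have hv := sum_range_ibinom_mul_ibinom (Nat.lt_succ_self (q - i))
        (show 0 ≤ M - q by omega) (j + s - i)
      rw [Nat.cast_sub hi'] at hv
      simp only [Nat.cast_add, add_sub_cancel_left, ← sub_sub]
      rw [hv, show (q - i + (M - q) : ℤ) = M - i by ring, ← ibinom_symm (M - i),
        show M - i - (j + s - i) = M - s - j by ring, mul_left_comm, ibinom_mul, ibinom_symm,
        show M - s - (M - s - j) = j by ring, show M - i - (M - s - j) = j + s - i by ring]
      ring
    _ = _ := by
      rw [← Finset.mul_sum, sum_range_ibinom_mul_ibinom (Nat.lt_succ_self q) hj]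

/-- The right-hand side sum in closed form. -/
theorem sum_ibinom_closed_form (a q z s : ℕ) (hs : s ≤ q) {N j : ℤ} (hN : N = a + q + z)
    (hj : 0 ≤ j) (hjN : j ≤ N) :
    ∑ u ∈ Finset.range (z + 1), ∑ v ∈ Finset.range (q - s + 1),
        ∑ w ∈ Finset.range (z - u + 1),
          ibinom z u * ibinom N (u + s) * ibinom (N - u + v) v *
            ibinom q (s + v) * ibinom (z - u) w * ibinom a (j - v - w) =
      ibinom N j * ibinom (q + j) (j + s) * ibinom (N + z - j) (s + z) := by
  have inner : ∀ u ∈ Finset.range (z + 1), ∑ v ∈ Finset.range (q - s + 1),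
      ∑ w ∈ Finset.range (z - u + 1), ibinom z u * ibinom N (u + s) * ibinom (N - u + v) v *
        ibinom q (s + v) * ibinom (z - u) w * ibinom a (j - v - w) =
      ibinom N j * ibinom (q + j) (j + s) *
        (ibinom z u * ibinom (N - j) (N - j - s - u)) := by
    intro u hu
    have huz : u ≤ z := Nat.lt_succ_iff.mp (Finset.mem_range.mp hu)
    calc
      _ = ∑ v ∈ Finset.range (q - s + 1), ibinom z u * ibinom N (u + s) *
            (ibinom (N - u - s + (s + v : ℕ)) (N - u) * ibinom q (s + v : ℕ) *
              ibinom (N - u - q) (j + s - (s + v : ℕ))) := by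
        refine Finset.sum_congr rfl fun v _ => ?_
        simp only [mul_assoc, ← Finset.mul_sum]
        have hv := sum_range_ibinom_mul_ibinom (Nat.lt_succ_self (z - u))
          (Int.natCast_nonneg a) (j - v)
        rw [Nat.cast_sub huz] at hv
        rw [hv, ← ibinom_symm (N - u + v), Nat.cast_add, add_sub_cancel_right,
          show (N - u - s + (s + v) : ℤ) = N - u + v by ring,
          show (j + s - (s + v) : ℤ) = j - v by ring,
          show (z - u + a : ℤ) = N - u - q by rw [hN]; ring]
      _ = ibinom z u * ibinom N (u + s) *
            (ibinom (N - u - s) j * ibinom (q + j) (j + s)) := by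
        rw [← Finset.mul_sum, ← sum_range_ibinom_saalschutz hs (by omega) hj,
          sum_range_shift hs fun k hk => by
            rw [ibinom_of_lt (by omega), zero_mul, zero_mul]]
      _ = _ := by
        have h := ibinom_mul N (N - j) (u + s)
        rw [ibinom_symm, ← ibinom_symm (N - j), show N - j - (u + s) = N - j - s - u by ring,
          show N - (u + s) = N - u - s by ring,
          show N - j - s - u = N - u - s - j by ring, ibinom_symm (N - u - s)] at h
        rw [show N - j - s - u = N - u - s - j by ring]
        linear_combination -(ibinom z u * ibinom (q + j) (j + s)) * h
  rw [Finset.sum_congr rfl inner, ← Finset.mul_sum,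
    sum_range_ibinom_mul_ibinom (Nat.lt_succ_self z) (by omega),
    ← ibinom_symm (N + z - j), show N + z - j - (s + z) = N - j - s by ring,
    show z + (N - j) = N + z - j by ring]

theorem choose_mul_choose_mul_choose_mul_choose (b j s r z : ℕ) :
    (b + (j + s)).choose (j + s) * (b + s + j).choose j * (r + (s + z)).choose (s + z) *
        (b + j + s + (r + s + z)).choose (r + s + z) =
      (b + s + z + (j + r + s)).choose (j + r + s) *
        ((b + s + j).choose j * (r + (j + s)).choose (j + s) * (b + (s + z)).choose (s + z)) := by
  have key (m k : ℕ) : ((m + k).choose k : ℚ) = (m + k).factorial / (m.factorial * k.factorial) := by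
    rw [Nat.add_comm, Nat.cast_add_choose, mul_comm]
  have h (m : ℕ) : (m.factorial : ℚ) ≠ 0 := by exact_mod_cast m.factorial_ne_zero
  rw [← Nat.cast_inj (R := ℚ)]
  push_cast [key]
  rw [show b + s + z + (j + r + s) = b + j + s + (r + s + z) by ring,
    show b + s + j = b + j + s by ring, show b + (j + s) = b + j + s by ring,
    show r + (s + z) = r + s + z by ring, show r + (j + s) = j + r + s by ring,
    show b + (s + z) = b + s + z by ring]
  field_simp [h]

/-- Let `n, t, q, z₂, s` be naturals with `s ≤ q`, `q + z₂ ≤ 2t`, `n ≥ 2t`,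
and set `N := n − 2t + q + z₂`. Then for every integer `j`:
`C(N, j+s) · C(N, j) · C(q+z₂, s+z₂) · C(N+q+z₂, q+z₂)
  = C(N+q+z₂, j+q) · Σ_{u=0}^{z₂} Σ_{v=0}^{q−s} Σ_{w=0}^{z₂−u}
      C(z₂,u)·C(N,u+s)·C(N−u+v,v)·C(q,s+v)·C(z₂−u,w)·C(n−2t, j−v−w)`. -/
theorem stmt_4 (n t q z₂ s : ℕ) (hs : s ≤ q) (hq : q + z₂ ≤ 2 * t) (hn : 2 * t ≤ n)
    (N : ℤ) (hN : N = (n : ℤ) - 2 * t + q + z₂) (j : ℤ) :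
    ibinom N (j + s) * ibinom N j * ibinom ((q : ℤ) + z₂) ((s : ℤ) + z₂) *
        ibinom (N + q + z₂) ((q : ℤ) + z₂) =
      ibinom (N + q + z₂) (j + q) *
        ∑ u ∈ Finset.range (z₂ + 1), ∑ v ∈ Finset.range (q - s + 1),
          ∑ w ∈ Finset.range (z₂ - u + 1),
            ibinom (z₂ : ℤ) (u : ℤ) * ibinom N ((u : ℤ) + s) * ibinom (N - u + v) (v : ℤ) *
              ibinom (q : ℤ) ((s : ℤ) + v) * ibinom ((z₂ : ℤ) - u) (w : ℤ) *
              ibinom ((n : ℤ) - 2 * t) (j - v - w) := by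
  have ha : (n : ℤ) - 2 * t = (n - 2 * t : ℕ) := by omega
  rw [ha] at hN ⊢
  generalize n - 2 * t = a at hN ⊢
  rcases lt_or_ge j 0 with hj | hj
  · rw [ibinom_of_neg N hj, Finset.sum_eq_zero fun u _ => Finset.sum_eq_zero fun v _ =>
      Finset.sum_eq_zero fun w _ => by rw [ibinom_of_neg a (by omega), mul_zero]]
    ring
  rcases lt_or_ge N (j + s) with hjN | hjN
  · rw [ibinom_of_lt hjN, Finset.sum_eq_zero fun u hu => Finset.sum_eq_zero fun v hv =>
      Finset.sum_eq_zero fun w hw => ?_]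
    · ring
    · rw [Finset.mem_range] at hu hv hw
      have hlt : (a : ℤ) < j - v - w := by omega
      simp only [ibinom_of_lt hlt, mul_zero]
  · rw [sum_ibinom_closed_form a q z₂ s hs hN hj (by omega)]
    lift j to ℕ using hj
    obtain ⟨r, rfl⟩ := Nat.exists_eq_add_of_le' hs
    obtain ⟨b, hb⟩ := Int.eq_ofNat_of_zero_le (sub_nonneg.mpr hjN)
    obtain rfl : N = (b + j + s : ℕ) := by push_cast; omega
    have h := choose_mul_choose_mul_choose_mul_choose b j s r z₂
    zify at h
    simp only [← ibinom_natCast] at h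
    push_cast at h ⊢
    ring_nf at h ⊢
    exact h
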